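/- For every fixed s > 0, the integral I(s,t) = ∫₀^s U(t−τ) u(τ) dτ satisfies lim_{t→∞} t^{1−α₂} (I(s,t) − U(s)U(t)) = −K(s). -/

import Mathlib

open Real MeasureTheory Filter Topology

/-- Two-parameter Mittag-Leffler function `E_{a,b}(x)`. -/
noncomputable def ML (a b x : ℝ) : ℝ :=
  ∑' k : ℕ, x ^ k / Real.Gamma ((k : ℝ) * a + b)

/-- Second-order (three-parameter, `γ = 2`) Mittag-Leffler function `E²_{a,b}(x)`. -/
noncomputable def ML2 (a b x : ℝ) : ℝ :=
  ∑' k : ℕ, ((k : ℝ) + 1) * x ^ k / Real.Gamma ((k : ℝ) * a + b)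

/-- Renewal function `U(t)` of the inverse mixed stable subordinator. -/
noncomputable def Ufun (a1 a2 C1 C2 t : ℝ) : ℝ :=
  t ^ a1 / C1 * ML (a1 - a2) (a1 + 1) (-C2 * t ^ (a1 - a2) / C1)

/-- Renewal density `u(t)` of the inverse mixed stable subordinator. -/
noncomputable def ufun (a1 a2 C1 C2 t : ℝ) : ℝ :=
  t ^ (a1 - 1) / C1 * ML (a1 - a2) a1 (-C2 * t ^ (a1 - a2) / C1)

/-- Covariance function of the inverse mixed stable subordinator. -/
noncomputable def CovY (a1 a2 C1 C2 s t : ℝ) : ℝ :=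
  (∫ τ in (0:ℝ)..(min s t),
      (Ufun a1 a2 C1 C2 (s - τ) + Ufun a1 a2 C1 C2 (t - τ)) * ufun a1 a2 C1 C2 τ)
    - Ufun a1 a2 C1 C2 s * Ufun a1 a2 C1 C2 t

/-- Variance function of the inverse mixed stable subordinator. -/
noncomputable def VarY (a1 a2 C1 C2 t : ℝ) : ℝ := CovY a1 a2 C1 C2 t t

/-- The integral `I(s,t) = ∫₀^s U(t-τ) u(τ) dτ`. -/
noncomputable def Ifun (a1 a2 C1 C2 s t : ℝ) : ℝ :=
  ∫ τ in (0:ℝ)..s, Ufun a1 a2 C1 C2 (t - τ) * ufun a1 a2 C1 C2 τ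

/-- The constant `K(s)`. -/
noncomputable def Kfun (a1 a2 C1 C2 s : ℝ) : ℝ :=
  s ^ (a1 + 1) / (C1 * C2 * Real.Gamma a2) *
    ∑' k : ℕ, ((k : ℝ) * (a1 - a2) + a1) * (-C2 * s ^ (a1 - a2) / C1) ^ k /
      Real.Gamma ((k : ℝ) * (a1 - a2) + a1 + 2)

/-- Covariance function of the mixed fractional Poisson process. -/
noncomputable def CovN (a1 a2 C1 C2 lam s t : ℝ) : ℝ :=
  lam * Ufun a1 a2 C1 C2 (min s t) + lam ^ 2 * CovY a1 a2 C1 C2 s t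

/-- Variance function of the mixed fractional Poisson process. -/
noncomputable def VarN (a1 a2 C1 C2 lam t : ℝ) : ℝ :=
  lam * Ufun a1 a2 C1 C2 t + lam ^ 2 * VarY a1 a2 C1 C2 t

/-- Correlation function of the inverse mixed stable subordinator. -/
noncomputable def CorrY (a1 a2 C1 C2 s t : ℝ) : ℝ :=
  CovY a1 a2 C1 C2 s t /
    (Real.sqrt (VarY a1 a2 C1 C2 s) * Real.sqrt (VarY a1 a2 C1 C2 t))

/-- Correlation function of the mixed fractional Poisson process. -/
noncomputable def CorrN (a1 a2 C1 C2 lam s t : ℝ) : ℝ :=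
  CovN a1 a2 C1 C2 lam s t /
    (Real.sqrt (VarN a1 a2 C1 C2 lam s) * Real.sqrt (VarN a1 a2 C1 C2 lam t))

/-- Covariance function of the mixed fractional Poissonian noise. -/
noncomputable def CovZ (a1 a2 C1 C2 lam δ s t : ℝ) : ℝ :=
  CovN a1 a2 C1 C2 lam (s + δ) (t + δ) + CovN a1 a2 C1 C2 lam s t
    - CovN a1 a2 C1 C2 lam (s + δ) t - CovN a1 a2 C1 C2 lam s (t + δ)

/-- Variance function of the mixed fractional Poissonian noise. -/
noncomputable def VarZ (a1 a2 C1 C2 lam δ t : ℝ) : ℝ := CovZ a1 a2 C1 C2 lam δ t t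

/-- Correlation function of the mixed fractional Poissonian noise. -/
noncomputable def CorrZ (a1 a2 C1 C2 lam δ s t : ℝ) : ℝ :=
  CovZ a1 a2 C1 C2 lam δ s t /
    (Real.sqrt (VarZ a1 a2 C1 C2 lam δ s) * Real.sqrt (VarZ a1 a2 C1 C2 lam δ t))

/-- Incomplete Beta function `B(a, b; x)`. -/
noncomputable def Binc (a b x : ℝ) : ℝ :=
  ∫ y in (0:ℝ)..x, y ^ (a - 1) * (1 - y) ^ (b - 1)

/-- A locally dominated integral of functions holomorphic in a parameter is holomorphic. -/
theorem differentiableOn_integral_of_locally_dominated {α : Type*} [MeasurableSpace α]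
    {μ : Measure α} {F : ℂ → α → ℂ} {U : Set ℂ}
    (hmeas : ∀ z ∈ U, AEStronglyMeasurable (F z) μ)
    (hdiff : ∀ a, DifferentiableOn ℂ (fun z => F z a) U)
    (hbound : ∀ z ∈ U, ∃ r > 0, Metric.ball z r ⊆ U ∧ ∃ g : α → ℝ, Integrable g μ ∧
      ∀ᵐ a ∂μ, ∀ w ∈ Metric.ball z r, ‖F w a‖ ≤ g a) :
    DifferentiableOn ℂ (fun z => ∫ a, F z a ∂μ) U := by
  intro z hz
  obtain ⟨r, hr, hrU, g, hg, hFg⟩ := hbound z hz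
  have hzr : z ∈ Metric.ball z r := Metric.mem_ball_self hr
  have hderiv : ∀ a, ∀ w ∈ Metric.ball z r,
      HasDerivAt (fun z => F z a) (deriv (fun z => F z a) w) w := fun a w hw =>
    (((hdiff a).mono hrU).differentiableAt (Metric.isOpen_ball.mem_nhds hw)).hasDerivAt
  have hseq : Tendsto (fun n : ℕ => z + ((r / 2) * (1 / ((n : ℝ) + 1)) : ℝ)) atTop (𝓝[≠] z) := by
    rw [tendsto_nhdsWithin_iff]
    constructor
    · have h := (tendsto_one_div_add_atTop_nhds_zero_nat (𝕜 := ℝ)).const_mul (r / 2)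
      have h' := (Complex.continuous_ofReal.tendsto _).comp h
      simpa using h'.const_add z
    · refine Eventually.of_forall fun n => ?_
      have : (r / 2) * (1 / ((n : ℝ) + 1)) ≠ 0 := by positivity
      simpa only [Set.mem_compl_iff, Set.mem_singleton_iff, add_eq_left, Complex.ofReal_eq_zero]
        using this
  have hF' : AEStronglyMeasurable (fun a => deriv (fun z => F z a) z) μ := by
    refine aestronglyMeasurable_of_tendsto_ae atTop (f := fun (n : ℕ) a =>
      slope (fun z => F z a) z (z + ((r / 2) * (1 / ((n : ℝ) + 1)) : ℝ))) (fun n => ?_)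
      (Eventually.of_forall fun a => (hasDerivAt_iff_tendsto_slope.1 (hderiv a z hzr)).comp hseq)
    have hmem : z + ((r / 2) * (1 / ((n : ℝ) + 1)) : ℝ) ∈ Metric.ball z r := by
      rw [Metric.mem_ball, dist_eq_norm, add_sub_cancel_left, Complex.norm_real, Real.norm_eq_abs,
        abs_of_pos (by positivity)]
      have : 1 / ((n : ℝ) + 1) ≤ 1 := by
        rw [div_le_one (by positivity)]; linarith [n.cast_nonneg (α := ℝ)]
      nlinarith
    exact ((hmeas _ (hrU hmem)).sub (hmeas z hz)).const_smul (𝕜 := ℂ) _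
  have hInt : Integrable (F z) μ :=
    hg.mono' (hmeas z hz) (hFg.mono fun a ha => ha z hzr)
  refine (hasDerivAt_integral_of_dominated_loc_of_deriv_le (s := Metric.ball z (r / 2))
    (bound := fun a => g a / (r / 4)) (F' := fun w a => deriv (fun z => F z a) w)
    (Metric.ball_mem_nhds z (by positivity)) ?_ hInt hF' ?_ (hg.div_const _)
    ?_).2.differentiableAt.differentiableWithinAt
  · filter_upwards [Metric.ball_mem_nhds z hr] with w hw using hmeas w (hrU hw)
  · filter_upwards [hFg] with a ha w hw
    have hsub : Metric.closedBall w (r / 4) ⊆ Metric.ball z r := by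
      intro v hv
      rw [Metric.mem_ball] at hw ⊢
      rw [Metric.mem_closedBall] at hv
      linarith [dist_triangle v w z]
    refine Complex.norm_deriv_le_of_forall_mem_sphere_norm_le (by positivity) ?_ fun v hv =>
      ha v (hsub (Metric.sphere_subset_closedBall hv))
    exact DifferentiableOn.diffContOnCl_ball ((hdiff a).mono hrU) hsub
  · exact Eventually.of_forall fun a w hw =>
      hderiv a w (Metric.ball_subset_ball (by linarith) hw)

/-- Two functions holomorphic on the right half-plane which agree on a real interval `(0, r)`
agree. -/
theorem eqOn_rightHalfPlane_of_eq_real {f g : ℂ → ℂ} {r : ℝ} (hr : 0 < r)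
    (hf : DifferentiableOn ℂ f {z | 0 < z.re}) (hg : DifferentiableOn ℂ g {z | 0 < z.re})
    (h : ∀ x : ℝ, 0 < x → x < r → f x = g x) : Set.EqOn f g {z | 0 < z.re} := by
  have ho : IsOpen {z : ℂ | 0 < z.re} := isOpen_lt continuous_const Complex.continuous_re
  refine AnalyticOnNhd.eqOn_of_preconnected_of_frequently_eq (z₀ := ((r / 2 : ℝ) : ℂ))
    (hf.analyticOnNhd ho) (hg.analyticOnNhd ho)
    (convex_halfSpace_re_gt 0).isPreconnected (by simpa using hr) ?_
  have hseq : Tendsto (fun n : ℕ => ((r / 2 + (r / 4) * (1 / ((n : ℝ) + 1)) : ℝ) : ℂ)) atTop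
      (𝓝[≠] ((r / 2 : ℝ) : ℂ)) := by
    rw [tendsto_nhdsWithin_iff]
    constructor
    · have h := (tendsto_one_div_add_atTop_nhds_zero_nat (𝕜 := ℝ)).const_mul (r / 4)
      have h' := (Complex.continuous_ofReal.tendsto _).comp (h.const_add (r / 2))
      simpa [Function.comp_def] using h'
    · refine Eventually.of_forall fun n => ?_
      have : (r / 4) * (1 / ((n : ℝ) + 1)) ≠ 0 := by positivity
      simpa only [Set.mem_compl_iff, Set.mem_singleton_iff, add_eq_left, Complex.ofReal_inj]
        using this
  refine hseq.frequently (Eventually.of_forall fun n => ?_).frequently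
  have h1 : 1 / ((n : ℝ) + 1) ≤ 1 := by
    rw [div_le_one (by positivity)]; linarith [n.cast_nonneg (α := ℝ)]
  refine h _ (by positivity) ?_
  nlinarith

/-- The Gamma integral with a complex rate. -/
theorem integral_rpow_mul_cexp_neg_mul_Ioi {c : ℝ} (hc : 0 < c) {z : ℂ} (hz : 0 < z.re) :
    ∫ t in Set.Ioi (0 : ℝ), ((t ^ (c - 1) : ℝ) : ℂ) * Complex.exp (-(z * t)) =
      z ^ (-(c : ℂ)) * Real.Gamma c := by
  refine eqOn_rightHalfPlane_of_eq_real
    (f := fun z => ∫ t in Set.Ioi (0 : ℝ), ((t ^ (c - 1) : ℝ) : ℂ) * Complex.exp (-(z * t)))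
    (g := fun z => z ^ (-(c : ℂ)) * Real.Gamma c) zero_lt_one ?_ ?_ ?_ hz
  · refine differentiableOn_integral_of_locally_dominated (fun z _ => ?_) (fun t => ?_) ?_
    · exact Measurable.aestronglyMeasurable (by fun_prop)
    · exact Differentiable.differentiableOn (by fun_prop)
    · intro z hz
      have hz' : 0 < z.re := hz
      have key : ∀ w ∈ Metric.ball z (z.re / 2), z.re / 2 < w.re := by
        intro w hw
        rw [Metric.mem_ball, dist_eq_norm] at hw
        have := (abs_le.1 (Complex.abs_re_le_norm (w - z))).1
        rw [Complex.sub_re] at this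
        linarith
      refine ⟨z.re / 2, by positivity, fun w hw => ?_,
        fun t => t ^ (c - 1) * rexp (-(z.re / 2) * t ^ (1 : ℝ)),
        integrableOn_rpow_mul_exp_neg_mul_rpow (by linarith) one_pos (by positivity), ?_⟩
      · have := key w hw
        change 0 < w.re
        linarith
      · filter_upwards [ae_restrict_mem measurableSet_Ioi] with t ht w hw
        have ht' : 0 < t := ht
        rw [norm_mul, Complex.norm_real, Complex.norm_exp, Real.norm_eq_abs,
          abs_of_pos (rpow_pos_of_pos ht' _), rpow_one]
        gcongr
        simp only [Complex.neg_re, Complex.mul_re, Complex.ofReal_re, Complex.ofReal_im, mul_zero,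
          sub_zero]
        nlinarith [key w hw]
  · intro z hz
    refine DifferentiableAt.differentiableWithinAt (DifferentiableAt.mul_const ?_ _)
    exact differentiableAt_id.cpow_const (Or.inl hz)
  · intro x hx _
    have h := Complex.integral_cpow_mul_exp_neg_mul_Ioi (a := (c : ℂ)) (by simpa using hc) hx
    rw [Complex.Gamma_ofReal, one_div, Complex.inv_cpow, ← Complex.cpow_neg] at h
    · refine Eq.trans (setIntegral_congr_fun measurableSet_Ioi fun t ht => ?_) h
      have ht' : 0 < t := ht
      rw [Complex.ofReal_cpow ht'.le]
      push_cast
      rfl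
    · rw [Complex.arg_ofReal_of_nonneg hx.le]
      exact Real.pi_pos.ne

/-- The vertical line `Re z = 1`, parametrised so that `ξ` is a Fourier frequency. -/
noncomputable def vline (ξ : ℝ) : ℂ := 1 + 2 * π * ξ * Complex.I

theorem vline_re (ξ : ℝ) : (vline ξ).re = 1 := by simp [vline]

theorem vline_im (ξ : ℝ) : (vline ξ).im = 2 * π * ξ := by simp [vline]

theorem continuous_vline : Continuous vline := by
  unfold vline; fun_prop

theorem vline_mem_slitPlane (ξ : ℝ) : vline ξ ∈ Complex.slitPlane :=
  Or.inl (by rw [vline_re]; exact one_pos)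

theorem vline_ne_zero (ξ : ℝ) : vline ξ ≠ 0 := Complex.slitPlane_ne_zero (vline_mem_slitPlane ξ)

theorem one_le_norm_vline (ξ : ℝ) : 1 ≤ ‖vline ξ‖ := by
  simpa [vline_re] using Complex.abs_re_le_norm (vline ξ)

theorem continuous_vline_cpow (c : ℂ) : Continuous fun ξ => vline ξ ^ c :=
  continuous_vline.cpow continuous_const vline_mem_slitPlane

theorem integrable_norm_vline_rpow {c : ℝ} (hc : 1 < c) :
    Integrable fun ξ => ‖vline ξ‖ ^ (-c) := by
  refine (integrable_rpow_neg_one_add_norm_sq (E := ℝ) (μ := volume) (r := c)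
    (by simpa using hc)).mono' ?_ (Eventually.of_forall fun ξ => ?_)
  · exact ((continuous_vline.norm).rpow_const fun ξ =>
      Or.inl (norm_ne_zero_iff.2 (vline_ne_zero ξ))).aestronglyMeasurable
  · rw [Real.norm_eq_abs, abs_of_nonneg (by positivity)]
    have h1 : 1 + ‖ξ‖ ^ 2 ≤ ‖vline ξ‖ ^ 2 := by
      rw [Complex.sq_norm, Complex.normSq_apply, vline_re, vline_im, Real.norm_eq_abs, sq_abs]
      nlinarith [Real.pi_gt_three, sq_nonneg ξ, mul_nonneg (sub_nonneg.2 Real.pi_gt_three.le)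
        (sq_nonneg ξ), mul_self_nonneg (π - 3), mul_nonneg (mul_self_nonneg (π - 3)) (sq_nonneg ξ)]
    have h2 : ‖vline ξ‖ ^ (-c) = (‖vline ξ‖ ^ 2) ^ (-c / 2) := by
      rw [← Real.rpow_natCast, ← Real.rpow_mul (norm_nonneg _)]
      congr 1
      push_cast
      ring
    rw [h2]
    exact Real.rpow_le_rpow_of_nonpos (by positivity) h1 (by linarith)

/-- Laplace inversion of a power: the Laplace integral for the reciprocal Gamma function. -/
theorem integral_cexp_vline_mul_cpow {c : ℝ} (hc : 1 < c) :
    ∫ ξ, Complex.exp (vline ξ) * vline ξ ^ (-(c : ℂ)) = ((Real.Gamma c)⁻¹ : ℝ) := by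
  have hG : 0 < Real.Gamma c := Real.Gamma_pos_of_pos (by linarith)
  set g : ℝ → ℂ := (Set.Ioi (0 : ℝ)).indicator fun t =>
    ((t ^ (c - 1) : ℝ) : ℂ) * Complex.exp (-((1 : ℂ) * t)) with hg
  have hgi : Integrable g := by
    rw [hg, integrable_indicator_iff measurableSet_Ioi]
    refine IntegrableOn.congr_fun (integrableOn_rpow_mul_exp_neg_mul_rpow (s := c - 1) (p := 1)
      (b := 1) (by linarith) one_pos one_pos).ofReal (fun t _ => ?_) measurableSet_Ioi
    simp
  have hF : ∀ ξ : ℝ, FourierTransform.fourier g ξ = vline ξ ^ (-(c : ℂ)) * Real.Gamma c := by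
    intro ξ
    rw [Real.fourier_real_eq_integral_exp_smul,
      ← integral_rpow_mul_cexp_neg_mul_Ioi (by linarith) (by rw [vline_re]; exact one_pos),
      ← integral_indicator measurableSet_Ioi]
    congr 1
    ext t
    by_cases ht : t ∈ Set.Ioi (0 : ℝ)
    · rw [hg, Set.indicator_of_mem ht, Set.indicator_of_mem ht, smul_eq_mul, mul_left_comm,
        ← Complex.exp_add]
      congr 2
      simp only [vline]
      push_cast
      ring
    · rw [hg, Set.indicator_of_notMem ht, Set.indicator_of_notMem ht, smul_zero]
  have hFi : Integrable (FourierTransform.fourier g) := by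
    rw [funext hF]
    refine Integrable.mul_const ((integrable_norm_vline_rpow hc).mono'
      (continuous_vline_cpow _).aestronglyMeasurable (Eventually.of_forall fun ξ => ?_)) _
    rw [← Complex.ofReal_neg, Complex.norm_cpow_real]
  have hcont : ContinuousAt g 1 := by
    have h1 : ContinuousAt (fun t : ℝ => ((t ^ (c - 1) : ℝ) : ℂ) * Complex.exp (-((1 : ℂ) * t))) 1 := by
      refine ContinuousAt.mul ?_ (by fun_prop)
      exact Complex.continuous_ofReal.continuousAt.comp
        (Real.continuousAt_rpow_const _ _ (Or.inl one_ne_zero))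
    refine h1.congr ?_
    filter_upwards [Ioi_mem_nhds (zero_lt_one (α := ℝ))] with t ht
    rw [hg, Set.indicator_of_mem ht]
  have h := hgi.fourierInv_fourier_eq hFi hcont
  rw [Real.fourierInv_eq', hg, Set.indicator_of_mem (Set.mem_Ioi.2 one_pos)] at h
  have h2 : ∀ ξ : ℝ, Complex.exp (vline ξ) * vline ξ ^ (-(c : ℂ)) =
      (Complex.exp 1 / Real.Gamma c) * (Complex.exp ((2 * π * inner ℝ ξ (1 : ℝ) : ℝ) * Complex.I) •
        FourierTransform.fourier g ξ) := by
    intro ξ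
    have hG' : (Real.Gamma c : ℂ) ≠ 0 := by exact_mod_cast hG.ne'
    rw [hF, smul_eq_mul]
    field_simp
    rw [mul_assoc, ← Complex.exp_add, mul_comm]
    congr 2
    simp [vline]
  simp_rw [h2]
  rw [integral_const_mul, h, Real.one_rpow]
  push_cast
  rw [one_mul, one_mul, div_mul_eq_mul_div, ← Complex.exp_add]
  simp

theorem rpow_mul_exp_neg_le_Gamma {c R : ℝ} (hc : 1 ≤ c) (hR : 0 < R) :
    R ^ (c - 1) * rexp (-R) ≤ Real.Gamma c := by
  have hint := Real.GammaIntegral_convergent (s := c) (by linarith)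
  have hsub : Set.Ioi R ⊆ Set.Ioi 0 := Set.Ioi_subset_Ioi hR.le
  rw [Real.Gamma_eq_integral (by linarith), ← integral_exp_neg_Ioi, ← integral_const_mul]
  calc ∫ x in Set.Ioi R, R ^ (c - 1) * rexp (-x)
      ≤ ∫ x in Set.Ioi R, rexp (-x) * x ^ (c - 1) := by
        refine setIntegral_mono_on ((integrableOn_exp_neg_Ioi R).const_mul _) (hint.mono_set hsub)
          measurableSet_Ioi fun x hx => ?_
        rw [mul_comm]
        have hx' : R < x := hx
        gcongr
    _ ≤ _ := setIntegral_mono_set hint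
        ((ae_restrict_mem measurableSet_Ioi).mono fun x hx =>
          mul_nonneg (exp_pos _).le (rpow_nonneg (le_of_lt hx) _)) hsub.eventuallyLE

theorem summable_pow_div_Gamma {a : ℝ} (ha : 0 < a) (b x : ℝ) :
    Summable fun k : ℕ => x ^ k / Real.Gamma ((k : ℝ) * a + b) := by
  set R : ℝ := (|x| + 1) ^ a⁻¹ * 2 ^ a⁻¹ with hR
  have hR0 : 0 < R := by positivity
  have hRa : R ^ a = 2 * (|x| + 1) := by
    rw [hR, mul_rpow (by positivity) (by positivity), rpow_inv_rpow (by positivity) ha.ne',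
      rpow_inv_rpow (by positivity) ha.ne', mul_comm]
  refine summable_of_isBigO_nat (summable_geometric_of_lt_one (r := 1 / 2) (by norm_num)
    (by norm_num)) (Asymptotics.IsBigO.of_bound (R ^ (1 - b) * rexp R) ?_)
  have hev : ∀ᶠ k : ℕ in atTop, 1 ≤ (k : ℝ) * a + b :=
    ((tendsto_natCast_atTop_atTop.atTop_mul_const ha).atTop_add tendsto_const_nhds).eventually
      (eventually_ge_atTop 1)
  filter_upwards [hev] with k hk
  have hG := rpow_mul_exp_neg_le_Gamma hk hR0
  have hG0 : 0 < Real.Gamma ((k : ℝ) * a + b) := Real.Gamma_pos_of_pos (by linarith)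
  rw [norm_div, norm_pow, Real.norm_eq_abs, Real.norm_of_nonneg hG0.le,
    Real.norm_of_nonneg (by positivity), div_le_iff₀ hG0]
  have hpow : R ^ ((k : ℝ) * a + b - 1) = (2 * (|x| + 1)) ^ k * R ^ (b - 1) := by
    rw [add_sub_assoc, rpow_add hR0, mul_comm (k : ℝ) a, rpow_mul hR0.le, hRa, rpow_natCast]
  calc |x| ^ k ≤ (|x| + 1) ^ k := by gcongr; linarith
    _ = R ^ (1 - b) * rexp R * (1 / 2) ^ k * (R ^ ((k : ℝ) * a + b - 1) * rexp (-R)) := by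
      have h1 : R ^ (1 - b) * R ^ (b - 1) = 1 := by
        rw [← rpow_add hR0]; simp
      have h2 : rexp R * rexp (-R) = 1 := by rw [← Real.exp_add]; simp
      have h3 : ((1 : ℝ) / 2) ^ k * (2 * (|x| + 1)) ^ k = (|x| + 1) ^ k := by
        rw [← mul_pow]; congr 1; ring
      rw [hpow]
      linear_combination (-(|x| + 1) ^ k) * h1 - (|x| + 1) ^ k * R ^ (1 - b) * R ^ (b - 1) * h2
        - R ^ (1 - b) * R ^ (b - 1) * (rexp R * rexp (-R)) * h3
    _ ≤ _ := by gcongr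

/-- The two-parameter Mittag-Leffler series defines an entire function. -/
theorem differentiable_tsum_pow_mul_inv_Gamma {a : ℝ} (ha : 0 < a) (b : ℝ) :
    Differentiable ℂ fun z : ℂ =>
      ∑' k : ℕ, z ^ k * ((Real.Gamma ((k : ℝ) * a + b))⁻¹ : ℝ) := by
  intro z
  refine (Complex.differentiableOn_tsum_of_summable_norm (U := Metric.ball 0 (‖z‖ + 1))
    (summable_pow_div_Gamma ha b (‖z‖ + 1)).norm (fun k => ?_) Metric.isOpen_ball
    fun k w hw => ?_).differentiableAt (Metric.isOpen_ball.mem_nhds (by simp))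
  · exact Differentiable.differentiableOn (by fun_prop)
  · rw [mem_ball_zero_iff] at hw
    rw [norm_mul, norm_pow, Complex.norm_real, div_eq_mul_inv, norm_mul, norm_pow,
      Real.norm_of_nonneg (by positivity : 0 ≤ ‖z‖ + 1)]
    gcongr

section Kernel

variable {d : ℝ} {z x : ℂ}

theorem cos_mul_norm_cpow_le_re (hd0 : 0 ≤ d) (hd2 : d ≤ 2) (hz : 0 ≤ z.re) :
    cos (π / 2 * d) * ‖z ^ (d : ℂ)‖ ≤ (z ^ (d : ℂ)).re := by
  have harg := Complex.abs_arg_le_pi_div_two_iff.2 hz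
  rw [Complex.norm_cpow_real, Complex.cpow_ofReal_re, mul_comm]
  refine mul_le_mul_of_nonneg_left ?_ (by positivity)
  rw [← cos_abs (z.arg * d), abs_mul, abs_of_nonneg hd0]
  exact cos_le_cos_of_nonneg_of_le_pi (by positivity) (by nlinarith [pi_pos])
    (mul_le_mul_of_nonneg_right harg hd0)

theorem cos_pi_div_two_mul_pos (hd0 : 0 < d) (hd1 : d < 1) : 0 < cos (π / 2 * d) :=
  cos_pos_of_mem_Ioo ⟨by nlinarith [pi_pos], by nlinarith [pi_pos]⟩

theorem cos_mul_norm_cpow_le_norm_add (hd0 : 0 < d) (hd1 : d < 1) (hz : 0 ≤ z.re)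
    (hx : 0 ≤ x.re) : cos (π / 2 * d) * ‖z ^ (d : ℂ)‖ ≤ ‖z ^ (d : ℂ) + x‖ :=
  (cos_mul_norm_cpow_le_re hd0.le (by linarith) hz).trans <|
    le_trans (by rw [Complex.add_re]; linarith) (Complex.re_le_norm _)

theorem cpow_add_ne_zero (hd0 : 0 < d) (hd1 : d < 1) (hz : 0 < z.re) (hx : 0 ≤ x.re) :
    z ^ (d : ℂ) + x ≠ 0 := by
  have hz0 : z ≠ 0 := fun h => by simp [h] at hz
  have h1 : 0 < ‖z ^ (d : ℂ)‖ := by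
    rw [Complex.norm_cpow_real]; exact rpow_pos_of_pos (norm_pos_iff.2 hz0) _
  exact norm_pos_iff.1 ((mul_pos (cos_pi_div_two_mul_pos hd0 hd1) h1).trans_le
    (cos_mul_norm_cpow_le_norm_add hd0 hd1 hz.le hx))

theorem norm_cpow_div_cpow_add_le (hd0 : 0 < d) (hd1 : d < 1) (hz : 0 < z.re) (hx : 0 ≤ x.re) :
    ‖z ^ (d : ℂ) / (z ^ (d : ℂ) + x)‖ ≤ (cos (π / 2 * d))⁻¹ := by
  have h0 := norm_pos_iff.2 (cpow_add_ne_zero hd0 hd1 hz hx)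
  rw [norm_div, div_le_iff₀ h0, inv_mul_eq_div,
    le_div_iff₀ (cos_pi_div_two_mul_pos hd0 hd1), mul_comm]
  exact cos_mul_norm_cpow_le_norm_add hd0 hd1 hz.le hx

theorem norm_div_cpow_add_le (hd0 : 0 < d) (hd1 : d < 1) (hz : 0 < z.re) (hx : 0 ≤ x.re) :
    ‖x / (z ^ (d : ℂ) + x)‖ ≤ 1 + (cos (π / 2 * d))⁻¹ := by
  have h : x / (z ^ (d : ℂ) + x) = 1 - z ^ (d : ℂ) / (z ^ (d : ℂ) + x) := by
    field_simp [cpow_add_ne_zero hd0 hd1 hz hx]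
    ring
  rw [h]
  refine (norm_sub_le _ _).trans ?_
  rw [norm_one]
  gcongr
  exact norm_cpow_div_cpow_add_le hd0 hd1 hz hx

end Kernel

theorem norm_cexp_vline_mul_cpow (c ξ : ℝ) :
    ‖Complex.exp (vline ξ) * vline ξ ^ (-(c : ℂ))‖ = rexp 1 * ‖vline ξ‖ ^ (-c) := by
  rw [norm_mul, Complex.norm_exp, vline_re, ← Complex.ofReal_neg, Complex.norm_cpow_real]

theorem continuous_cexp_vline_mul_cpow (c : ℂ) :
    Continuous fun ξ => Complex.exp (vline ξ) * vline ξ ^ c :=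
  (Complex.continuous_exp.comp continuous_vline).mul (continuous_vline_cpow _)

/-- The integrand of the Laplace inversion integral of the Mittag-Leffler function. -/
noncomputable def mlKernel (d b : ℝ) (x : ℂ) (ξ : ℝ) : ℂ :=
  Complex.exp (vline ξ) * vline ξ ^ (-((b + 1 : ℝ) : ℂ)) *
    ((b - d) * (vline ξ ^ (d : ℂ) / (vline ξ ^ (d : ℂ) + x)) +
      d * (vline ξ ^ (d : ℂ) / (vline ξ ^ (d : ℂ) + x)) ^ 2)

theorem continuous_mlKernel {d : ℝ} (hd0 : 0 < d) (hd1 : d < 1) (b : ℝ) {x : ℂ} (hx : 0 ≤ x.re) :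
    Continuous (mlKernel d b x) := by
  have h : Continuous fun ξ => vline ξ ^ (d : ℂ) / (vline ξ ^ (d : ℂ) + x) :=
    (continuous_vline_cpow _).div ((continuous_vline_cpow _).add continuous_const) fun ξ =>
      cpow_add_ne_zero hd0 hd1 (by rw [vline_re]; exact one_pos) hx
  exact (continuous_cexp_vline_mul_cpow _).mul
    ((continuous_const.mul h).add (continuous_const.mul (h.pow 2)))

theorem norm_mlKernel_le {d : ℝ} (hd0 : 0 < d) (hd1 : d < 1) (b : ℝ) {x : ℂ} (hx : 0 ≤ x.re)
    (ξ : ℝ) : ‖mlKernel d b x ξ‖ ≤ rexp 1 * ‖vline ξ‖ ^ (-(b + 1)) *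
      (|b - d| * (cos (π / 2 * d))⁻¹ + d * (cos (π / 2 * d))⁻¹ ^ 2) := by
  have hp := norm_cpow_div_cpow_add_le hd0 hd1 (by rw [vline_re]; exact one_pos : 0 < (vline ξ).re) hx
  rw [mlKernel, norm_mul, norm_cexp_vline_mul_cpow]
  refine mul_le_mul_of_nonneg_left ((norm_add_le _ _).trans ?_) (by positivity)
  rw [norm_mul, norm_mul, norm_pow, ← Complex.ofReal_sub, Complex.norm_real, Complex.norm_real,
    Real.norm_eq_abs, Real.norm_of_nonneg hd0.le]
  gcongr

theorem differentiableOn_integral_mlKernel {d b : ℝ} (hd0 : 0 < d) (hd1 : d < 1) (hb : 0 < b) :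
    DifferentiableOn ℂ (fun x => ∫ ξ, mlKernel d b x ξ) {x | 0 < x.re} := by
  have ho : IsOpen {z : ℂ | 0 < z.re} := isOpen_lt continuous_const Complex.continuous_re
  refine differentiableOn_integral_of_locally_dominated
    (fun x hx => (continuous_mlKernel hd0 hd1 b (le_of_lt hx)).aestronglyMeasurable)
    (fun ξ x hx => ?_) fun x hx => ?_
  · have hne : vline ξ ^ (d : ℂ) + x ≠ 0 :=
      cpow_add_ne_zero hd0 hd1 (by rw [vline_re]; exact one_pos) (le_of_lt hx)
    have h : DifferentiableAt ℂ (fun x => vline ξ ^ (d : ℂ) / (vline ξ ^ (d : ℂ) + x)) x :=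
      (differentiableAt_const _).div (by fun_prop) hne
    exact (((h.const_mul _).add ((h.pow 2).const_mul _)).const_mul _).differentiableWithinAt
  · obtain ⟨r, hr, hrU⟩ := Metric.isOpen_iff.1 ho x hx
    exact ⟨r, hr, hrU, _, (((integrable_norm_vline_rpow (by linarith)).const_mul _).mul_const _),
      Eventually.of_forall fun ξ w hw => norm_mlKernel_le hd0 hd1 b (le_of_lt (hrU hw)) ξ⟩

theorem hasSum_mlKernel {d b x : ℝ} (hd0 : 0 < d) (hd1 : d < 1) (hx0 : 0 < x) (hx1 : x < 1)
    (ξ : ℝ) :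
    HasSum (fun k : ℕ => ((-x) ^ k * ((k : ℝ) * d + b) : ℝ) *
      (Complex.exp (vline ξ) * vline ξ ^ (-(((k : ℝ) * d + b + 1 : ℝ) : ℂ))))
      (mlKernel d b x ξ) := by
  set ζ := vline ξ ^ (d : ℂ) with hζ
  have hne : ζ + x ≠ 0 :=
    cpow_add_ne_zero hd0 hd1 (by rw [vline_re]; exact one_pos) (by simpa using hx0.le)
  have hζ1 : 1 ≤ ‖ζ‖ := by
    rw [hζ, Complex.norm_cpow_real]; exact one_le_rpow (one_le_norm_vline ξ) hd0.le
  have hζ0 : ζ ≠ 0 := norm_pos_iff.1 (by linarith)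
  have hr : ‖-(x : ℂ) / ζ‖ < 1 := by
    rw [norm_div, norm_neg, Complex.norm_real, Real.norm_of_nonneg hx0.le,
      div_lt_one (by linarith)]
    linarith
  have h := (((hasSum_coe_mul_geometric_of_norm_lt_one hr).mul_left (d : ℂ)).add
    ((hasSum_geometric_of_norm_lt_one hr).mul_left (b : ℂ))).mul_left
    (Complex.exp (vline ξ) * vline ξ ^ (-((b + 1 : ℝ) : ℂ)))
  have hval : mlKernel d b x ξ = Complex.exp (vline ξ) * vline ξ ^ (-((b + 1 : ℝ) : ℂ)) *
      (d * (-(x : ℂ) / ζ / (1 - -(x : ℂ) / ζ) ^ 2) + b * (1 - -(x : ℂ) / ζ)⁻¹) := by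
    rw [mlKernel, ← hζ]
    congr 1
    have h1 : 1 - -(x : ℂ) / ζ = (ζ + x) / ζ := by field_simp; ring
    rw [h1]
    field_simp
    ring
  rw [hval]
  refine h.congr_fun fun k => ?_
  have hsplit : vline ξ ^ (-(((k : ℝ) * d + b + 1 : ℝ) : ℂ)) =
      vline ξ ^ (-((b + 1 : ℝ) : ℂ)) * (ζ⁻¹) ^ k := by
    rw [hζ, ← Complex.cpow_neg, ← Complex.cpow_nat_mul, ← Complex.cpow_add _ _ (vline_ne_zero ξ)]
    congr 1
    push_cast
    ring
  rw [hsplit, div_eq_mul_inv, mul_pow]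
  push_cast
  ring

theorem integral_mlKernel_of_lt_one {d b x : ℝ} (hd0 : 0 < d) (hd1 : d < 1) (hb : 0 < b)
    (hx0 : 0 < x) (hx1 : x < 1) :
    HasSum (fun k : ℕ => (-(x : ℂ)) ^ k * ((Real.Gamma ((k : ℝ) * d + b))⁻¹ : ℝ))
      (∫ ξ, mlKernel d b x ξ) := by
  have hpos : ∀ k : ℕ, 0 < (k : ℝ) * d + b := fun k => by positivity
  have hnorm : ∀ (k : ℕ) (ξ : ℝ), ‖(((-x) ^ k * ((k : ℝ) * d + b) : ℝ) : ℂ) *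
      (Complex.exp (vline ξ) * vline ξ ^ (-(((k : ℝ) * d + b + 1 : ℝ) : ℂ)))‖ =
      x ^ k * ((k : ℝ) * d + b) * (rexp 1 * ‖vline ξ‖ ^ (-((k : ℝ) * d + b + 1))) := by
    intro k ξ
    rw [norm_mul, norm_cexp_vline_mul_cpow, Complex.norm_real, norm_mul, norm_pow, norm_neg,
      Real.norm_of_nonneg hx0.le, Real.norm_of_nonneg (hpos k).le]
  have h := hasSum_integral_of_summable_integral_norm (μ := volume) (F := fun (k : ℕ) ξ =>
    (((-x) ^ k * ((k : ℝ) * d + b) : ℝ) : ℂ) *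
      (Complex.exp (vline ξ) * vline ξ ^ (-(((k : ℝ) * d + b + 1 : ℝ) : ℂ)))) (fun k => ?_) ?_
  · simp_rw [(hasSum_mlKernel hd0 hd1 hx0 hx1 _).tsum_eq] at h
    refine h.congr_fun fun k => ?_
    rw [integral_const_mul, integral_cexp_vline_mul_cpow (by linarith [hpos k]),
      Real.Gamma_add_one (hpos k).ne']
    have h1 : ((Real.Gamma ((k : ℝ) * d + b) : ℝ) : ℂ) ≠ 0 := by
      exact_mod_cast (Real.Gamma_pos_of_pos (hpos k)).ne'
    have h2 : (((k : ℝ) * d + b : ℝ) : ℂ) ≠ 0 := by exact_mod_cast (hpos k).ne'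
    rw [mul_inv, Complex.ofReal_mul, Complex.ofReal_mul, Complex.ofReal_inv ((k : ℝ) * d + b), mul_assoc,
      mul_inv_cancel_left₀ h2]
    push_cast
    rfl
  · refine Integrable.mono' (((integrable_norm_vline_rpow (by linarith [hpos k])).const_mul
      (rexp 1)).const_mul _) ?_ (Eventually.of_forall fun ξ => (hnorm k ξ).le)
    exact (continuous_const.mul (continuous_cexp_vline_mul_cpow _)).aestronglyMeasurable
  · simp_rw [hnorm]
    have hs : Summable fun k : ℕ => x ^ k * ((k : ℝ) * d + b) *
        (∫ ξ, rexp 1 * ‖vline ξ‖ ^ (-(b + 1))) := by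
      have hxn : ‖x‖ < 1 := by rwa [Real.norm_of_nonneg hx0.le]
      have := (((hasSum_coe_mul_geometric_of_norm_lt_one hxn).mul_left d).add
        ((hasSum_geometric_of_norm_lt_one hxn).mul_left b)).summable
      refine Summable.mul_right _ (this.congr fun k => by ring)
    refine hs.of_nonneg_of_le (fun k => integral_nonneg fun ξ => ?_) fun k => ?_
    · have := hpos k
      positivity
    · rw [integral_const_mul]
      have := hpos k
      refine mul_le_mul_of_nonneg_left (integral_mono
        ((integrable_norm_vline_rpow (by linarith)).const_mul _)
        ((integrable_norm_vline_rpow (by linarith)).const_mul _) fun ξ => ?_) (by positivity)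
      refine mul_le_mul_of_nonneg_left (rpow_le_rpow_of_exponent_le (one_le_norm_vline ξ) ?_)
        (by positivity)
      have : 0 ≤ (k : ℝ) * d := by positivity
      linarith

theorem integral_mlKernel {d b : ℝ} (hd0 : 0 < d) (hd1 : d < 1) (hb : 0 < b) {x : ℝ}
    (hx : 0 < x) : ∫ ξ, mlKernel d b x ξ = ML d b (-x) := by
  have h := eqOn_rightHalfPlane_of_eq_real one_pos
    (differentiableOn_integral_mlKernel hd0 hd1 hb)
    (((differentiable_tsum_pow_mul_inv_Gamma hd0 b).comp differentiable_neg).differentiableOn)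
    (fun y hy0 hy1 => (integral_mlKernel_of_lt_one hd0 hd1 hb hy0 hy1).tsum_eq.symm)
    (show 0 < (x : ℂ).re by simpa using hx)
  simp only [Function.comp_apply] at h
  rw [h, ML, Complex.ofReal_tsum]
  congr 1
  ext k
  push_cast
  rw [div_eq_mul_inv]

/-- Leading asymptotics of the Mittag-Leffler function on the negative axis. -/
theorem tendsto_mul_ML_neg {d b : ℝ} (hd0 : 0 < d) (hd1 : d < 1) (hdb : d < b) :
    Tendsto (fun x => x * ML d b (-x)) atTop (𝓝 (Real.Gamma (b - d))⁻¹) := by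
  have hbd : 0 < b - d := sub_pos.2 hdb
  set M := (cos (π / 2 * d))⁻¹
  have hlim : ∫ ξ, Complex.exp (vline ξ) * vline ξ ^ (-((b - d + 1 : ℝ) : ℂ)) *
      ((b - d : ℝ) : ℂ) = ((Real.Gamma (b - d))⁻¹ : ℝ) := by
    rw [integral_mul_const, integral_cexp_vline_mul_cpow (by linarith),
      Real.Gamma_add_one hbd.ne', ← Complex.ofReal_mul, mul_inv, mul_right_comm,
      inv_mul_cancel₀ hbd.ne', one_mul]
  have heq : ∀ x : ℝ, 0 < x → ∀ ξ, x * mlKernel d b x ξ =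
      Complex.exp (vline ξ) * vline ξ ^ (-((b - d + 1 : ℝ) : ℂ)) *
      (x / (vline ξ ^ (d : ℂ) + x) *
        ((b - d : ℝ) + d * (vline ξ ^ (d : ℂ) / (vline ξ ^ (d : ℂ) + x)))) := by
    intro x hx ξ
    have hsplit : vline ξ ^ (-((b - d + 1 : ℝ) : ℂ)) =
        vline ξ ^ (-((b + 1 : ℝ) : ℂ)) * vline ξ ^ (d : ℂ) := by
      rw [← Complex.cpow_add _ _ (vline_ne_zero ξ)]
      congr 1
      push_cast
      ring
    rw [mlKernel, hsplit]
    push_cast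
    ring
  have hT : Tendsto (fun x : ℝ => ∫ ξ, (x : ℂ) * mlKernel d b x ξ) atTop
      (𝓝 (∫ ξ, Complex.exp (vline ξ) * vline ξ ^ (-((b - d + 1 : ℝ) : ℂ)) *
      ((b - d : ℝ) : ℂ))) := by
    refine tendsto_integral_filter_of_dominated_convergence
      (fun ξ => rexp 1 * ‖vline ξ‖ ^ (-(b - d + 1)) * ((1 + M) * (b - d + d * M))) ?_ ?_
      (((integrable_norm_vline_rpow (by linarith)).const_mul _).mul_const _)
      (Eventually.of_forall fun ξ => ?_)
    · filter_upwards [eventually_gt_atTop 0] with x hx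
      exact (continuous_const.mul
        (continuous_mlKernel hd0 hd1 b (by simpa using hx.le))).aestronglyMeasurable
    · filter_upwards [eventually_gt_atTop 0] with x hx
      refine Eventually.of_forall fun ξ => ?_
      have hre : 0 < (vline ξ).re := by rw [vline_re]; exact one_pos
      have hxre : 0 ≤ (x : ℂ).re := by simpa using hx.le
      have hM : 0 < M := inv_pos.2 (cos_pi_div_two_mul_pos hd0 hd1)
      rw [heq x hx, norm_mul, norm_cexp_vline_mul_cpow, norm_mul]
      refine mul_le_mul_of_nonneg_left (mul_le_mul (norm_div_cpow_add_le hd0 hd1 hre hxre)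
        ((norm_add_le _ _).trans ?_) (norm_nonneg _) (by positivity)) (by positivity)
      rw [norm_mul, Complex.norm_real, Complex.norm_real, Real.norm_of_nonneg hbd.le,
        Real.norm_of_nonneg hd0.le]
      gcongr
      exact norm_cpow_div_cpow_add_le hd0 hd1 hre hxre
    · have hp : Tendsto (fun x : ℝ => vline ξ ^ (d : ℂ) / (vline ξ ^ (d : ℂ) + x)) atTop (𝓝 0) := by
        refine squeeze_zero_norm' ?_ (tendsto_const_nhds.div_atTop tendsto_id :
          Tendsto (fun x : ℝ => ‖vline ξ ^ (d : ℂ)‖ / x) atTop (𝓝 0))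
        filter_upwards [eventually_gt_atTop 0] with x hx
        have h0 := cos_mul_norm_cpow_le_re (z := vline ξ) hd0.le (by linarith)
          (by rw [vline_re]; exact zero_le_one)
        have h1 := mul_nonneg (cos_pi_div_two_mul_pos hd0 hd1).le (norm_nonneg (vline ξ ^ (d : ℂ)))
        have h2 := Complex.re_le_norm (vline ξ ^ (d : ℂ) + x)
        rw [Complex.add_re, Complex.ofReal_re] at h2
        rw [norm_div]
        gcongr
        linarith
      have hm : Tendsto (fun x : ℝ => (x : ℂ) / (vline ξ ^ (d : ℂ) + x)) atTop (𝓝 1) := by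
        have h1 := hp.const_sub 1
        rw [sub_zero] at h1
        refine h1.congr' ?_
        filter_upwards [eventually_gt_atTop 0] with x hx
        have := cpow_add_ne_zero hd0 hd1 (by rw [vline_re]; exact one_pos : 0 < (vline ξ).re)
          (by simpa using hx.le : 0 ≤ (x : ℂ).re)
        field_simp
        ring
      have h2 := (hm.mul ((hp.const_mul (d : ℂ)).const_add ((b - d : ℝ) : ℂ))).const_mul
        (Complex.exp (vline ξ) * vline ξ ^ (-((b - d + 1 : ℝ) : ℂ)))
      rw [mul_zero, add_zero, one_mul] at h2
      refine h2.congr' ?_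
      filter_upwards [eventually_gt_atTop 0] with x hx
      exact (heq x hx ξ).symm
  rw [hlim] at hT
  have hR := (Complex.continuous_re.tendsto _).comp hT
  rw [Complex.ofReal_re] at hR
  refine hR.congr' ?_
  filter_upwards [eventually_gt_atTop 0] with x hx
  rw [Function.comp_apply, integral_const_mul, integral_mlKernel hd0 hd1 (hd0.trans hdb) hx,
    ← Complex.ofReal_mul, Complex.ofReal_re]

theorem continuous_ML {a : ℝ} (ha : 0 < a) (b : ℝ) : Continuous (ML a b) := by
  have h := Complex.continuous_re.comp
    ((differentiable_tsum_pow_mul_inv_Gamma ha b).continuous.comp Complex.continuous_ofReal)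
  refine h.congr fun x => ?_
  rw [Function.comp_apply, Function.comp_apply, ML, ← Complex.ofReal_re (∑' k : ℕ, _),
    Complex.ofReal_tsum]
  congr 2
  ext k
  push_cast
  rw [div_eq_mul_inv]

/-- Termwise integration of a fractional power series. -/
theorem hasSum_integral_rpow_series {d β s : ℝ} (hd : 0 < d) (hβ : 0 < β) (hs : 0 < s)
    {w : ℕ → ℝ} (hw : Summable fun k => w k * (s ^ d) ^ k) :
    HasSum (fun k : ℕ => w k * (s ^ ((k : ℝ) * d + β) / ((k : ℝ) * d + β)))
      (∫ t in (0 : ℝ)..s, t ^ (β - 1) * ∑' k, w k * (t ^ d) ^ k) := by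
  have hpos : ∀ k : ℕ, 0 < (k : ℝ) * d + β := fun k => by positivity
  have hint : ∀ k : ℕ, ∫ t in Set.Ioc 0 s, t ^ ((k : ℝ) * d + β - 1) =
      s ^ ((k : ℝ) * d + β) / ((k : ℝ) * d + β) := by
    intro k
    rw [← intervalIntegral.integral_of_le hs.le, integral_rpow (Or.inl (by linarith [hpos k])),
      sub_add_cancel, Real.zero_rpow (hpos k).ne', sub_zero]
  have hii : ∀ k : ℕ, IntegrableOn (fun t : ℝ => t ^ ((k : ℝ) * d + β - 1)) (Set.Ioc 0 s) :=
    fun k => (intervalIntegrable_iff_integrableOn_Ioc_of_le hs.le).1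
      (intervalIntegral.intervalIntegrable_rpow' (by linarith [hpos k]))
  have h := hasSum_integral_of_summable_integral_norm (μ := volume.restrict (Set.Ioc 0 s))
    (F := fun (k : ℕ) t => w k * t ^ ((k : ℝ) * d + β - 1)) (fun k => (hii k).const_mul _) ?_
  · simp_rw [integral_const_mul, hint] at h
    have heq : ∫ t in (0 : ℝ)..s, t ^ (β - 1) * ∑' k, w k * (t ^ d) ^ k =
        ∫ t in Set.Ioc 0 s, ∑' k : ℕ, w k * t ^ ((k : ℝ) * d + β - 1) := by
      rw [intervalIntegral.integral_of_le hs.le]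
      refine setIntegral_congr_fun measurableSet_Ioc fun t ht => ?_
      rw [← tsum_mul_left]
      refine tsum_congr fun k => ?_
      rw [add_sub_assoc, rpow_add ht.1, mul_comm (k : ℝ) d, rpow_mul ht.1.le, rpow_natCast]
      ring
    rwa [heq]
  · refine Summable.of_nonneg_of_le (fun k => integral_nonneg fun t => norm_nonneg _) (fun k => ?_)
      (hw.norm.mul_right (s ^ β / β))
    have h1 : ∫ t in Set.Ioc 0 s, ‖w k * t ^ ((k : ℝ) * d + β - 1)‖ =
        ‖w k‖ * (s ^ ((k : ℝ) * d + β) / ((k : ℝ) * d + β)) := by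
      rw [← hint, ← integral_const_mul]
      refine setIntegral_congr_fun measurableSet_Ioc fun t ht => ?_
      rw [norm_mul, Real.norm_of_nonneg (rpow_nonneg ht.1.le _)]
    rw [h1, norm_mul, Real.norm_of_nonneg (by positivity : 0 ≤ (s ^ d) ^ k), mul_assoc,
      rpow_add hs, mul_comm (k : ℝ) d, rpow_mul hs.le, rpow_natCast, mul_div_assoc]
    have h2 : 0 ≤ d * (k : ℝ) := by positivity
    gcongr
    linarith

theorem eventually_forall_mem_Icc_abs_rpow_mul_sub_le {u : ℝ → ℝ} {r L : ℝ} (s : ℝ) (hs : 0 ≤ s)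
    (hL : Tendsto (fun t => t ^ r * u t) atTop (𝓝 L)) {ε : ℝ} (hε : 0 < ε) :
    ∀ᶠ t in atTop, ∀ y ∈ Set.Icc (t - s) t, |t ^ r * u y - L| ≤ ε := by
  classical
  have hex : ∀ t : ℝ, ∃ y ∈ Set.Icc (t - s) t,
      |t ^ r * u y - L| ≤ ε → ∀ y ∈ Set.Icc (t - s) t, |t ^ r * u y - L| ≤ ε := by
    intro t
    by_cases h : ∀ y ∈ Set.Icc (t - s) t, |t ^ r * u y - L| ≤ ε
    · exact ⟨t, ⟨by linarith, le_rfl⟩, fun _ => h⟩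
    · push Not at h
      obtain ⟨y, hy, hy'⟩ := h
      exact ⟨y, hy, fun hc => absurd hc (not_le.2 hy')⟩
  choose η hη hη' using hex
  have hηtop : Tendsto η atTop atTop :=
    tendsto_atTop_mono (fun t => (hη t).1) (tendsto_atTop_add_const_right _ (-s) tendsto_id)
  have hratio : Tendsto (fun t => t / η t) atTop (𝓝 1) := by
    have h1 : Tendsto (fun t => 1 + s / η t) atTop (𝓝 1) := by
      simpa using (tendsto_const_nhds.div_atTop hηtop).const_add (1 : ℝ)
    refine tendsto_of_tendsto_of_tendsto_of_le_of_le' tendsto_const_nhds h1 ?_ ?_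
    · filter_upwards [hηtop.eventually_gt_atTop 0] with t ht
      rw [one_le_div ht]
      exact (hη t).2
    · filter_upwards [hηtop.eventually_gt_atTop 0] with t ht
      rw [div_le_iff₀ ht, add_mul, div_mul_cancel₀ _ ht.ne']
      linarith [(hη t).1]
  have hlim : Tendsto (fun t => t ^ r * u (η t)) atTop (𝓝 L) := by
    have h := (hratio.rpow_const (p := r) (Or.inl one_ne_zero)).mul (hL.comp hηtop)
    rw [one_rpow, one_mul] at h
    refine h.congr' ?_
    filter_upwards [hηtop.eventually_gt_atTop 0, eventually_gt_atTop 0] with t ht ht0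
    rw [Function.comp_apply, div_rpow ht0.le ht.le, ← mul_assoc,
      div_mul_cancel₀ _ (rpow_pos_of_pos ht _).ne']
  filter_upwards [Metric.tendsto_nhds.1 hlim ε hε] with t ht
  exact hη' t (by rw [← Real.dist_eq]; exact ht.le)

/-- If `u` is asymptotic to `L * t ^ (-r)`, its increments integrate accordingly against `v`. -/
theorem tendsto_rpow_mul_integral_increment {u v : ℝ → ℝ} {r L s : ℝ} (hs : 0 ≤ s)
    (hu : ∀ x y, IntervalIntegrable u volume x y) (hv : IntervalIntegrable v volume 0 s)
    (hL : Tendsto (fun t => t ^ r * u t) atTop (𝓝 L)) :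
    Tendsto (fun t => ∫ τ in (0 : ℝ)..s, t ^ r * (∫ y in (t - τ)..t, u y) * v τ) atTop
      (𝓝 (∫ τ in (0 : ℝ)..s, L * τ * v τ)) := by
  have key : ∀ ε > 0, ∀ᶠ t in atTop, ∀ τ ∈ Set.Icc 0 s,
      |t ^ r * (∫ y in (t - τ)..t, u y) - L * τ| ≤ ε * τ := by
    intro ε hε
    filter_upwards [eventually_forall_mem_Icc_abs_rpow_mul_sub_le s hs hL hε] with t ht τ hτ
    have h1 : t ^ r * (∫ y in (t - τ)..t, u y) - L * τ =
        ∫ y in (t - τ)..t, (t ^ r * u y - L) := by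
      rw [intervalIntegral.integral_sub ((hu _ _).const_mul _) intervalIntegrable_const,
        intervalIntegral.integral_const_mul, intervalIntegral.integral_const, smul_eq_mul]
      ring
    have h2 := intervalIntegral.norm_integral_le_of_norm_le_const (a := t - τ) (b := t)
      (f := fun y => t ^ r * u y - L) (C := ε) fun y hy => by
        rw [Set.uIoc_of_le (by linarith [hτ.1])] at hy
        exact ht y ⟨by linarith [hy.1, hτ.2], hy.2⟩
    rw [h1]
    simpa [abs_of_nonneg hτ.1] using h2
  have hprim : ∀ t, Continuous fun τ => ∫ y in (t - τ)..t, u y := by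
    intro t
    have h := (intervalIntegral.continuous_primitive hu t).comp (continuous_const.sub continuous_id :
      Continuous fun τ : ℝ => t - τ)
    refine h.neg.congr fun τ => ?_
    exact (intervalIntegral.integral_symm _ _).symm
  refine intervalIntegral.tendsto_integral_filter_of_dominated_convergence
    (fun τ => (|L| + 1) * s * ‖v τ‖) ?_ ?_ (hv.norm.const_mul _) ?_
  · refine Eventually.of_forall fun t => ?_
    rw [Set.uIoc_of_le hs]
    refine AEStronglyMeasurable.mul ?_ hv.1.aestronglyMeasurable
    exact (continuous_const.mul (hprim t)).aestronglyMeasurable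
  · filter_upwards [key 1 one_pos] with t ht
    refine Eventually.of_forall fun τ hτ => ?_
    rw [Set.uIoc_of_le hs] at hτ
    have h1 := ht τ ⟨hτ.1.le, hτ.2⟩
    rw [norm_mul]
    refine mul_le_mul_of_nonneg_right ?_ (norm_nonneg _)
    have h2 := abs_sub_abs_le_abs_sub (t ^ r * ∫ y in (t - τ)..t, u y) (L * τ)
    rw [abs_mul L, abs_of_pos hτ.1] at h2
    rw [Real.norm_eq_abs]
    nlinarith [hτ.2, abs_nonneg L, mul_le_mul_of_nonneg_left hτ.2 (abs_nonneg L)]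
  · refine Eventually.of_forall fun τ hτ => Tendsto.mul_const _ ?_
    rw [Set.uIoc_of_le hs] at hτ
    rw [Metric.tendsto_nhds]
    intro ε hε
    have hpos : 0 < ε / (2 * τ) := div_pos hε (by linarith [hτ.1])
    filter_upwards [key _ hpos] with t ht
    have h1 := ht τ ⟨hτ.1.le, hτ.2⟩
    rw [Real.dist_eq]
    refine h1.trans_lt ?_
    have h0 := hτ.1
    have : ε / (2 * τ) * τ = ε / 2 := by field_simp
    linarith

section Renewal

variable {a1 a2 C1 C2 : ℝ}

theorem continuous_ML_comp_rpow (ha12 : a2 < a1) (b : ℝ) :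
    Continuous fun t : ℝ => ML (a1 - a2) b (-C2 * t ^ (a1 - a2) / C1) :=
  (continuous_ML (sub_pos.2 ha12) b).comp
    ((continuous_const.mul (Real.continuous_rpow_const (sub_pos.2 ha12).le)).div_const _)

theorem intervalIntegrable_ufun (ha1 : 0 < a1) (ha12 : a2 < a1) (x y : ℝ) :
    IntervalIntegrable (ufun a1 a2 C1 C2) volume x y :=
  ((intervalIntegral.intervalIntegrable_rpow' (by linarith)).div_const C1).mul_continuousOn
    (continuous_ML_comp_rpow ha12 a1).continuousOn

theorem continuous_Ufun (ha1 : 0 < a1) (ha12 : a2 < a1) : Continuous (Ufun a1 a2 C1 C2) :=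
  ((Real.continuous_rpow_const ha1.le).div_const C1).mul (continuous_ML_comp_rpow ha12 (a1 + 1))

theorem hasSum_integral_rpow_mul_ML {s β : ℝ} (ha12 : a2 < a1) (hβ : 0 < β) (hs : 0 < s) :
    HasSum (fun k : ℕ => (-C2 / C1) ^ k / Real.Gamma ((k : ℝ) * (a1 - a2) + a1) *
        (s ^ ((k : ℝ) * (a1 - a2) + β) / ((k : ℝ) * (a1 - a2) + β)))
      (∫ t in (0 : ℝ)..s, t ^ (β - 1) * ML (a1 - a2) a1 (-C2 * t ^ (a1 - a2) / C1)) := by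
  have hterm : ∀ (t : ℝ) (k : ℕ), (-C2 / C1) ^ k / Real.Gamma ((k : ℝ) * (a1 - a2) + a1) *
      (t ^ (a1 - a2)) ^ k =
      (-C2 * t ^ (a1 - a2) / C1) ^ k / Real.Gamma ((k : ℝ) * (a1 - a2) + a1) := by
    intro t k
    rw [div_mul_eq_mul_div, ← mul_pow, div_mul_eq_mul_div]
  have h := hasSum_integral_rpow_series (sub_pos.2 ha12) hβ hs
    (w := fun k : ℕ => (-C2 / C1) ^ k / Real.Gamma ((k : ℝ) * (a1 - a2) + a1))
    (by simp_rw [hterm]; exact summable_pow_div_Gamma (sub_pos.2 ha12) _ _)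
  simp_rw [hterm] at h
  exact h

theorem integral_ufun {t : ℝ} (ha1 : 0 < a1) (ha12 : a2 < a1) (ht : 0 < t) :
    ∫ y in (0 : ℝ)..t, ufun a1 a2 C1 C2 y = Ufun a1 a2 C1 C2 t := by
  have h := hasSum_integral_rpow_mul_ML (C1 := C1) (C2 := C2) ha12 ha1 ht
  simp_rw [ufun, Ufun, div_mul_eq_mul_div]
  rw [intervalIntegral.integral_div, ← h.tsum_eq, ML, ← tsum_mul_left]
  congr 2
  ext k
  have hpos : 0 < (k : ℝ) * (a1 - a2) + a1 := by
    have := sub_pos.2 ha12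
    positivity
  rw [← add_assoc, Real.Gamma_add_one hpos.ne', rpow_add ht, mul_comm (k : ℝ), rpow_mul ht.le,
    rpow_natCast, div_pow, div_pow, mul_pow]
  field_simp

theorem integral_mul_ufun {s : ℝ} (ha1 : 0 < a1) (ha12 : a2 < a1) (hs : 0 < s) :
    ∫ t in (0 : ℝ)..s, 1 / (C2 * Real.Gamma a2) * t * ufun a1 a2 C1 C2 t =
      Kfun a1 a2 C1 C2 s := by
  have h := hasSum_integral_rpow_mul_ML (C1 := C1) (C2 := C2) ha12
    (by linarith : 0 < a1 + 1) hs
  have h1 : ∀ t ∈ Set.uIcc 0 s, 1 / (C2 * Real.Gamma a2) * t * ufun a1 a2 C1 C2 t =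
      1 / (C1 * C2 * Real.Gamma a2) *
        (t ^ (a1 + 1 - 1) * ML (a1 - a2) a1 (-C2 * t ^ (a1 - a2) / C1)) := by
    intro t ht
    rw [Set.uIcc_of_le hs.le] at ht
    have h2 : t ^ (a1 + 1 - 1) = t * t ^ (a1 - 1) := by
      rcases ht.1.eq_or_lt with h0 | h0
      · rw [← h0, add_sub_cancel_right, zero_rpow ha1.ne', zero_mul]
      · rw [← rpow_one_add' h0.le (by linarith)]
        congr 1
        ring
    rw [h2, ufun]
    simp only [div_eq_mul_inv, mul_inv]
    ring
  rw [intervalIntegral.integral_congr h1, intervalIntegral.integral_const_mul, ← h.tsum_eq, Kfun,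
    div_eq_mul_one_div (s ^ (a1 + 1)), mul_comm (s ^ (a1 + 1)), mul_assoc (1 / _),
    ← tsum_mul_left (a := s ^ (a1 + 1))]
  congr 1
  refine tsum_congr fun k => ?_
  have hpos : 0 < (k : ℝ) * (a1 - a2) + a1 := by
    have := sub_pos.2 ha12
    positivity
  have hG : Real.Gamma ((k : ℝ) * (a1 - a2) + a1 + 2) = ((k : ℝ) * (a1 - a2) + a1 + 1) *
      (((k : ℝ) * (a1 - a2) + a1) * Real.Gamma ((k : ℝ) * (a1 - a2) + a1)) := by
    rw [← Real.Gamma_add_one hpos.ne', ← Real.Gamma_add_one (by linarith)]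
    congr 1
    ring
  have hG0 := (Real.Gamma_pos_of_pos hpos).ne'
  rw [hG, rpow_add hs, mul_comm (k : ℝ), rpow_mul hs.le, rpow_natCast, div_pow, div_pow, mul_pow,
    ← add_assoc]
  rw [mul_comm (k : ℝ)] at hpos hG0
  field_simp

theorem tendsto_rpow_mul_ufun (ha2 : 0 < a2) (ha12 : a2 < a1) (ha1 : a1 < 1) (hC1 : 0 < C1)
    (hC2 : 0 < C2) :
    Tendsto (fun t => t ^ (1 - a2) * ufun a1 a2 C1 C2 t) atTop
      (𝓝 (1 / (C2 * Real.Gamma a2))) := by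
  have hd := sub_pos.2 ha12
  have hx : Tendsto (fun t : ℝ => C2 / C1 * t ^ (a1 - a2)) atTop atTop :=
    (tendsto_rpow_atTop hd).const_mul_atTop (div_pos hC2 hC1)
  have h := ((tendsto_mul_ML_neg hd (by linarith) (by linarith : a1 - a2 < a1)).comp hx).const_mul
    (1 / C2)
  rw [sub_sub_cancel, one_div_mul_eq_div, inv_eq_one_div, div_div, mul_comm] at h
  refine h.congr' ?_
  filter_upwards [eventually_gt_atTop 0] with t ht
  have h1 : t ^ (a1 - a2) = t ^ (1 - a2) * t ^ (a1 - 1) := by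
    rw [← rpow_add ht]
    congr 1
    ring
  have h2 : -(C2 / C1 * t ^ (a1 - a2)) = -C2 * t ^ (a1 - a2) / C1 := by ring
  rw [Function.comp_apply, h2, ufun]
  generalize ML (a1 - a2) a1 _ = m
  rw [h1]
  field_simp

end Renewal

/-- For every fixed `s > 0`, `t^{1-α₂}(I(s,t) - U(s)U(t)) → -K(s)` as `t → ∞`. -/
theorem stmt_10 (a1 a2 C1 C2 : ℝ) (ha2 : 0 < a2) (ha12 : a2 < a1) (ha1 : a1 < 1)
    (hC1 : 0 < C1) (hC2 : 0 < C2) (hC : C1 + C2 = 1) (s : ℝ) (hs : 0 < s) :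
    Tendsto (fun t : ℝ => t ^ (1 - a2) *
        (Ifun a1 a2 C1 C2 s t - Ufun a1 a2 C1 C2 s * Ufun a1 a2 C1 C2 t))
      atTop (𝓝 (-(Kfun a1 a2 C1 C2 s))) := by
  have ha1' : 0 < a1 := ha2.trans ha12
  have hu := intervalIntegrable_ufun (C1 := C1) (C2 := C2) ha1' ha12
  have h := (tendsto_rpow_mul_integral_increment hs.le hu (hu 0 s)
    (tendsto_rpow_mul_ufun ha2 ha12 ha1 hC1 hC2)).neg
  rw [integral_mul_ufun ha1' ha12 hs] at h
  refine h.congr' ?_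
  filter_upwards [eventually_gt_atTop s] with t ht
  have h1 : ∀ τ ∈ Set.uIcc 0 s,
      t ^ (1 - a2) * (∫ y in (t - τ)..t, ufun a1 a2 C1 C2 y) * ufun a1 a2 C1 C2 τ =
        t ^ (1 - a2) * (Ufun a1 a2 C1 C2 t * ufun a1 a2 C1 C2 τ -
          Ufun a1 a2 C1 C2 (t - τ) * ufun a1 a2 C1 C2 τ) := by
    intro τ hτ
    rw [Set.uIcc_of_le hs.le] at hτ
    rw [← intervalIntegral.integral_interval_sub_left (hu 0 t) (hu 0 (t - τ)),
      integral_ufun ha1' ha12 (by linarith), integral_ufun ha1' ha12 (by linarith [hτ.2])]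
    ring
  have h2 : IntervalIntegrable (fun τ => Ufun a1 a2 C1 C2 (t - τ) * ufun a1 a2 C1 C2 τ)
      volume 0 s :=
    (hu 0 s).continuousOn_mul
      ((continuous_Ufun ha1' ha12).comp (continuous_const.sub continuous_id)).continuousOn
  rw [intervalIntegral.integral_congr h1, intervalIntegral.integral_const_mul,
    intervalIntegral.integral_sub ((hu 0 s).const_mul _) h2, intervalIntegral.integral_const_mul,
    integral_ufun ha1' ha12 hs, Ifun]
  ring
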